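/- Let q be a prime power with 3 | q−1, let μ ∈ F_q not be a cube in F_q, write F_{q^3} = F_q(ζ) with ζ³ = μ, and let A, B ∈ F_q. For x_0, x_1, x_2 ∈ F_q set X = x_0 + x_1 ζ + x_2 ζ². Then f_3(X, X^q, X^{q^2}) = −3 x_0⁴ − 12 μ² x_0 x_2³ − 12 μ x_0 x_1³ + 18 μ x_0² x_1 x_2 + 9 μ² x_1² x_2² − 6A x_0² + 6A μ x_1 x_2 − 12B x_0 + A², an element of F_q. -/

import Mathlib

/-- The third Semaev polynomial of the elliptic curve `y² = x³ + Ax + B`. -/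
def semaev3 {R : Type*} [CommRing R] (A B z₁ z₂ z₃ : R) : R :=
  (z₁ - z₂) ^ 2 * z₃ ^ 2 - 2 * ((z₁ + z₂) * (z₁ * z₂ + A) + 2 * B) * z₃ +
    (z₁ * z₂ - A) ^ 2 - 4 * B * (z₁ + z₂)

/-- An element of an extension of the finite field `F` fixed by `x ↦ x ^ #F` lies in `F`. -/
lemma FiniteField.exists_algebraMap_eq_of_pow_card_eq {F K : Type*} [Field F] [Fintype F]
    [Field K] [Algebra F K] {x : K} (hx : x ^ Fintype.card F = x) :
    ∃ c : F, algebraMap F K c = x := by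
  classical
  have hp : (Polynomial.X ^ Fintype.card F - Polynomial.X : Polynomial K) ≠ 0 :=
    FiniteField.X_pow_card_sub_X_ne_zero K Fintype.one_lt_card
  have hsub : Finset.univ.image (algebraMap F K) ⊆
      (Polynomial.X ^ Fintype.card F - Polynomial.X : Polynomial K).roots.toFinset := by
    intro y hy
    obtain ⟨c, -, rfl⟩ := Finset.mem_image.mp hy
    simp [hp, ← map_pow, FiniteField.pow_card]
  have heq := Finset.eq_of_subset_of_card_le hsub (by
    rw [Finset.card_image_of_injective _ (algebraMap F K).injective, Finset.card_univ]
    refine (Multiset.toFinset_card_le _).trans ((Polynomial.card_roots' _).trans_eq ?_)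
    exact FiniteField.X_pow_card_sub_X_natDegree_eq K Fintype.one_lt_card)
  have hmem : x ∈ Finset.univ.image (algebraMap F K) := by
    rw [heq]
    simp [hp, hx]
  simpa using hmem

/-- The third Semaev polynomial at the three conjugates of `a + b + c` under the order three
action `b ↦ ω b`, `c ↦ ω² c`. -/
lemma semaev3_conjugates {R : Type*} [CommRing R] {ω : R} (hω : ω ^ 2 + ω + 1 = 0)
    (A B a b c : R) :
    semaev3 A B (a + b + c) (a + ω * b + ω ^ 2 * c) (a + ω ^ 2 * b + ω * c) =
      -3 * a ^ 4 - 12 * a * c ^ 3 - 12 * a * b ^ 3 + 18 * a ^ 2 * b * c + 9 * b ^ 2 * c ^ 2 -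
        6 * A * a ^ 2 + 6 * A * b * c - 12 * B * a + A ^ 2 := by
  have h2 : ω ^ 2 = -1 - ω := by linear_combination hω
  rw [semaev3, h2]
  grind

/-- Let `q` be a prime power with `3 ∣ q − 1`, let `μ ∈ F_q` not be a cube in
`F_q`, write `F_{q³} = F_q(ζ)` with `ζ³ = μ`, and let `A, B ∈ F_q`. For `x₀, x₁, x₂ ∈ F_q` and
`X = x₀ + x₁ ζ + x₂ ζ²` one has
`f_3(X, X^q, X^{q²}) = −3x₀⁴ − 12μ²x₀x₂³ − 12μx₀x₁³ + 18μx₀²x₁x₂ + 9μ²x₁²x₂² − 6Ax₀² + 6Aμx₁x₂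
  − 12Bx₀ + A²`, an element of `F_q`. -/
theorem weil_restriction_semaev3_cubic
    {Fq K : Type*} [Field Fq] [Fintype Fq] [Field K] [Fintype K] [Algebra Fq K]
    (q : ℕ) (hq : q = Fintype.card Fq) (hq3 : 3 ∣ q - 1)
    (μ : Fq) (hμ : ¬∃ c : Fq, c ^ 3 = μ)
    (hcard : Fintype.card K = q ^ 3)
    (ζ : K) (hζ : ζ ^ 3 = algebraMap Fq K μ)
    (A B : Fq)
    (x₀ x₁ x₂ : Fq) (X : K)
    (hX : X = algebraMap Fq K x₀ + algebraMap Fq K x₁ * ζ + algebraMap Fq K x₂ * ζ ^ 2) :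
    semaev3 (algebraMap Fq K A) (algebraMap Fq K B) X (X ^ q) (X ^ q ^ 2) =
      algebraMap Fq K (-3 * x₀ ^ 4 - 12 * μ ^ 2 * x₀ * x₂ ^ 3 - 12 * μ * x₀ * x₁ ^ 3 +
        18 * μ * x₀ ^ 2 * x₁ * x₂ + 9 * μ ^ 2 * x₁ ^ 2 * x₂ ^ 2 - 6 * A * x₀ ^ 2 +
        6 * A * μ * x₁ * x₂ - 12 * B * x₀ + A ^ 2) := by
  subst hq
  obtain ⟨k, hk⟩ := hq3
  have hqk : Fintype.card Fq = 3 * k + 1 := by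
    have := Fintype.card_pos (α := Fq)
    omega
  have hμ0 : μ ≠ 0 := fun h => hμ ⟨0, by simp [h]⟩
  have hζ0 : ζ ≠ 0 := by
    rintro rfl
    exact hμ0 ((algebraMap Fq K).injective (by simpa using hζ.symm))
  set ω : K := algebraMap Fq K (μ ^ k) with hωdef
  have hζq : ζ ^ Fintype.card Fq = ω * ζ := by
    rw [hqk, pow_succ, pow_mul, hζ, hωdef, map_pow]
  have hω3 : ω ^ 3 = 1 := by
    rw [hωdef, ← map_pow, ← pow_mul, mul_comm k 3, ← hk, FiniteField.pow_card_sub_one_eq_one μ hμ0,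
      map_one]
  have hω1 : ω ≠ 1 := by
    intro h
    obtain ⟨c, hc⟩ := FiniteField.exists_algebraMap_eq_of_pow_card_eq (F := Fq)
      (hζq.trans (by rw [h, one_mul]))
    exact hμ ⟨c, (algebraMap Fq K).injective (by rw [map_pow, hc, hζ])⟩
  have hω : ω ^ 2 + ω + 1 = 0 :=
    mul_left_cancel₀ (sub_ne_zero.mpr hω1) (by linear_combination hω3)
  have hF : ∀ y : K, FiniteField.frobeniusAlgHom Fq K y = y ^ Fintype.card Fq := fun _ => rfl
  have hXq : X ^ Fintype.card Fq = algebraMap Fq K x₀ + ω * (algebraMap Fq K x₁ * ζ) +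
      ω ^ 2 * (algebraMap Fq K x₂ * ζ ^ 2) := by
    rw [← hF, hX]
    simp only [map_add, map_mul, map_pow, AlgHom.commutes, hF ζ, hζq]
    ring
  have hXqq : X ^ Fintype.card Fq ^ 2 = algebraMap Fq K x₀ + ω ^ 2 * (algebraMap Fq K x₁ * ζ) +
      ω * (algebraMap Fq K x₂ * ζ ^ 2) := by
    have hFω : FiniteField.frobeniusAlgHom Fq K ω = ω := AlgHom.commutes _ _
    rw [sq, pow_mul, hXq, ← hF]
    simp only [map_add, map_mul, map_pow, AlgHom.commutes, hF ζ, hζq, hFω]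
    linear_combination ω * (algebraMap Fq K x₂ * ζ ^ 2) * hω3
  rw [hXqq, hXq, hX, semaev3_conjugates hω]
  simp only [map_add, map_sub, map_mul, map_pow, map_neg, map_ofNat, ← hζ]
  ring
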